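/- arXiv:1205.3562 — 3 statements merged into one kernel-verified Lean document; each statement's English description precedes it below -/
import Mathlib

section
/- The coefficients of the first fundamental forms of a patch and of its inverse patch satisfy Ẽ = λ²E, F̃ = λ²F, and G̃ = λ²G at every point (u,v), where Ẽ = ⟨y_u,y_u⟩, F̃ = ⟨y_u,y_v⟩, G̃ = ⟨y_v,y_v⟩ and E = ⟨x_u,x_u⟩, F = ⟨x_u,x_v⟩, G = ⟨x_v,x_v⟩. -/
noncomputable section
open scoped RealInnerProductSpace

/-- ℝ³ as Euclidean 3-space. -/
abbrev E3 : Type := EuclideanSpace ℝ (Fin 3)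

/-- The cross product on ℝ³. -/
def cross (a b : E3) : E3 :=
  (WithLp.equiv 2 (Fin 3 → ℝ)).symm
    ![a 1 * b 2 - a 2 * b 1, a 2 * b 0 - a 0 * b 2, a 0 * b 1 - a 1 * b 0]

/-- The inversion of ℝ³ with center `c` and radius `r`. -/
def inv3 (c : E3) (r : ℝ) (p : E3) : E3 :=
  c + (r ^ 2 / ‖p - c‖ ^ 2) • (p - c)

/-- Partial derivative in the first variable. -/
def pu {E : Type*} [NormedAddCommGroup E] [NormedSpace ℝ E]
    (x : ℝ → ℝ → E) (u v : ℝ) : E :=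
  deriv (fun t => x t v) u

/-- Partial derivative in the second variable. -/
def pv {E : Type*} [NormedAddCommGroup E] [NormedSpace ℝ E]
    (x : ℝ → ℝ → E) (u v : ℝ) : E :=
  deriv (fun t => x u t) v

/-- The unit normal of a patch. -/
def unormal (x : ℝ → ℝ → E3) (u v : ℝ) : E3 :=
  ‖cross (pu x u v) (pv x u v)‖⁻¹ • cross (pu x u v) (pv x u v)

/-- The conformal factor λ of the inversion along the patch. -/
def lam (c : E3) (r : ℝ) (x : ℝ → ℝ → E3) (u v : ℝ) : ℝ :=
  r ^ 2 / ‖x u v - c‖ ^ 2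

/-- The support-type function η = ⟨U_x, x − c⟩. -/
def eta (c : E3) (x : ℝ → ℝ → E3) (u v : ℝ) : ℝ :=
  ⟪unormal x u v, x u v - c⟫

/-- First fundamental form coefficient E. -/
def FFE (x : ℝ → ℝ → E3) (u v : ℝ) : ℝ := ⟪pu x u v, pu x u v⟫
/-- First fundamental form coefficient F. -/
def FFF (x : ℝ → ℝ → E3) (u v : ℝ) : ℝ := ⟪pu x u v, pv x u v⟫
/-- First fundamental form coefficient G. -/
def FFG (x : ℝ → ℝ → E3) (u v : ℝ) : ℝ := ⟪pv x u v, pv x u v⟫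
/-- Second fundamental form coefficient e. -/
def SFe (x : ℝ → ℝ → E3) (u v : ℝ) : ℝ := ⟪pu (pu x) u v, unormal x u v⟫
/-- Second fundamental form coefficient f. -/
def SFf (x : ℝ → ℝ → E3) (u v : ℝ) : ℝ := ⟪pv (pu x) u v, unormal x u v⟫
/-- Second fundamental form coefficient g. -/
def SFg (x : ℝ → ℝ → E3) (u v : ℝ) : ℝ := ⟪pv (pv x) u v, unormal x u v⟫
/-- Third fundamental form coefficient P. -/
def TFP (x : ℝ → ℝ → E3) (u v : ℝ) : ℝ := ⟪pu (unormal x) u v, pu (unormal x) u v⟫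
/-- Third fundamental form coefficient Q. -/
def TFQ (x : ℝ → ℝ → E3) (u v : ℝ) : ℝ := ⟪pu (unormal x) u v, pv (unormal x) u v⟫
/-- Third fundamental form coefficient R. -/
def TFR (x : ℝ → ℝ → E3) (u v : ℝ) : ℝ := ⟪pv (unormal x) u v, pv (unormal x) u v⟫

/-- Christoffel symbol Γ¹₁₁. -/
def Ch111 (x : ℝ → ℝ → E3) (u v : ℝ) : ℝ :=
  (FFG x u v * pu (FFE x) u v - 2 * FFF x u v * pu (FFF x) u v + FFF x u v * pv (FFE x) u v) /
    (2 * (FFE x u v * FFG x u v - FFF x u v ^ 2))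
/-- Christoffel symbol Γ²₁₁. -/
def Ch211 (x : ℝ → ℝ → E3) (u v : ℝ) : ℝ :=
  (2 * FFE x u v * pu (FFF x) u v - FFE x u v * pv (FFE x) u v - FFF x u v * pu (FFE x) u v) /
    (2 * (FFE x u v * FFG x u v - FFF x u v ^ 2))
/-- Christoffel symbol Γ¹₁₂. -/
def Ch112 (x : ℝ → ℝ → E3) (u v : ℝ) : ℝ :=
  (FFG x u v * pv (FFE x) u v - FFF x u v * pu (FFG x) u v) /
    (2 * (FFE x u v * FFG x u v - FFF x u v ^ 2))
/-- Christoffel symbol Γ²₁₂. -/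
def Ch212 (x : ℝ → ℝ → E3) (u v : ℝ) : ℝ :=
  (FFE x u v * pu (FFG x) u v - FFF x u v * pv (FFE x) u v) /
    (2 * (FFE x u v * FFG x u v - FFF x u v ^ 2))
/-- Christoffel symbol Γ¹₂₂. -/
def Ch122 (x : ℝ → ℝ → E3) (u v : ℝ) : ℝ :=
  (2 * FFG x u v * pv (FFF x) u v - FFG x u v * pu (FFG x) u v - FFF x u v * pv (FFG x) u v) /
    (2 * (FFE x u v * FFG x u v - FFF x u v ^ 2))
/-- Christoffel symbol Γ²₂₂. -/
def Ch222 (x : ℝ → ℝ → E3) (u v : ℝ) : ℝ :=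
  (FFE x u v * pv (FFG x) u v - 2 * FFF x u v * pv (FFF x) u v + FFF x u v * pu (FFG x) u v) /
    (2 * (FFE x u v * FFG x u v - FFF x u v ^ 2))

/-- The tangent map of the inversion at `p`. -/
def phiStar (c : E3) (r : ℝ) (p : E3) (w : E3) : E3 :=
  (r ^ 2 / ‖p - c‖ ^ 2) • w - (2 * r ^ 2 * ⟪p - c, w⟫ / ‖p - c‖ ^ 4) • (p - c)

theorem inv3_eq_inversion (c : E3) (r : ℝ) (p : E3) :
    inv3 c r p = EuclideanGeometry.inversion c r p := by
  simp [inv3, EuclideanGeometry.inversion, dist_eq_norm, div_pow, add_comm]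

theorem deriv_inv3_comp {c : E3} {r : ℝ} {γ : ℝ → E3} {t : ℝ}
    (hγ : DifferentiableAt ℝ γ t) (hc : γ t ≠ c) :
    deriv (fun s => inv3 c r (γ s)) t =
      (r ^ 2 / ‖γ t - c‖ ^ 2) • (ℝ ∙ (γ t - c))ᗮ.reflection (deriv γ t) := by
  simp only [inv3_eq_inversion]
  have h := (EuclideanGeometry.hasFDerivAt_inversion (R := r) hc).comp_hasDerivAt t hγ.hasDerivAt
  simpa [dist_eq_norm, div_pow, Function.comp_def] using h.deriv

theorem inner_smul_reflection_smul_reflection (K : Submodule ℝ E3) [K.HasOrthogonalProjection]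
    (l : ℝ) (a b : E3) :
    ⟪l • K.reflection a, l • K.reflection b⟫ = l ^ 2 * ⟪a, b⟫ := by
  rw [real_inner_smul_left, real_inner_smul_right, LinearIsometryEquiv.inner_map_map]
  ring

theorem inverse_patch_first_fundamental_form
    (c : E3) (r : ℝ) (hr : 0 < r)
    (x : ℝ → ℝ → E3)
    (hx : ContDiff ℝ (⊤ : ℕ∞) (fun p : ℝ × ℝ => x p.1 p.2))
    (hxc : ∀ u v : ℝ, x u v ≠ c)
    (y : ℝ → ℝ → E3) (hy : ∀ u v : ℝ, y u v = inv3 c r (x u v)) :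
    ∀ u v : ℝ,
      FFE y u v = (lam c r x u v) ^ 2 * FFE x u v ∧
      FFF y u v = (lam c r x u v) ^ 2 * FFF x u v ∧
      FFG y u v = (lam c r x u v) ^ 2 * FFG x u v := by
  intro u v
  have hd : Differentiable ℝ (fun p : ℝ × ℝ => x p.1 p.2) := hx.differentiable (by simp)
  have hu : DifferentiableAt ℝ (fun t => x t v) u :=
    (hd (u, v)).comp u (f := fun t : ℝ => (t, v)) (by fun_prop)
  have hv : DifferentiableAt ℝ (fun t => x u t) v :=
    (hd (u, v)).comp v (f := fun t : ℝ => (u, t)) (by fun_prop)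
  have hyu : pu y u v = lam c r x u v • (ℝ ∙ (x u v - c))ᗮ.reflection (pu x u v) := by
    simp only [pu, hy]
    exact deriv_inv3_comp hu (hxc u v)
  have hyv : pv y u v = lam c r x u v • (ℝ ∙ (x u v - c))ᗮ.reflection (pv x u v) := by
    simp only [pv, hy]
    exact deriv_inv3_comp hv (hxc u v)
  simp only [FFE, FFF, FFG, hyu, hyv, inner_smul_reflection_smul_reflection, and_self]
end
end

section
/- (Corollary 3.3) If x is a patch whose first fundamental form is diagonal, i.e. F = 0 everywhere, then the Christoffel symbols of x and of its inverse patch are related by: Γ̃¹₁₁ = Γ¹₁₁ + (2λ²)⁻¹(λ²)_u, Γ̃²₁₁ = Γ²₁₁ − (2λ²)⁻¹(E/G)(λ²)_v, Γ̃¹₁₂ = Γ¹₁₂ + (2λ²)⁻¹(λ²)_v, Γ̃²₁₂ = Γ²₁₂ + (2λ²)⁻¹(λ²)_u, Γ̃¹₂₂ = Γ¹₂₂ − (2λ²)⁻¹(G/E)(λ²)_u, and Γ̃²₂₂ = Γ²₂₂ + (2λ²)⁻¹(λ²)_v. -/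
noncomputable section
open scoped RealInnerProductSpace

/-- The inversion preserves inner products of tangent vectors up to the squared conformal factor. -/
lemma exists_hasFDerivAt_inv3 (c : E3) (r : ℝ) {p : E3} (hp : p ≠ c) :
    ∃ L : E3 →L[ℝ] E3, HasFDerivAt (inv3 c r) L p ∧
      ∀ a b : E3, ⟪L a, L b⟫ = (r ^ 2 / ‖p - c‖ ^ 2) ^ 2 * ⟪a, b⟫ := by
  have h : inv3 c r = EuclideanGeometry.inversion c r := by
    funext q
    simp only [inv3, EuclideanGeometry.inversion, dist_eq_norm, div_pow, vsub_eq_sub,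
      vadd_eq_add, add_comm]
  refine ⟨_, h ▸ EuclideanGeometry.hasFDerivAt_inversion hp, fun a b => ?_⟩
  simp only [smul_apply, inner_smul_left, inner_smul_right, dist_eq_norm,
    div_pow]
  simp only [ContinuousLinearEquiv.coe_coe, LinearIsometryEquiv.coe_toContinuousLinearEquiv,
    LinearIsometryEquiv.inner_map_map, conj_trivial]
  ring

section PartialDerivatives

variable {V : Type*} [NormedAddCommGroup V] [NormedSpace ℝ V]

lemma ContDiff.hasDerivAt_pu {f : ℝ → ℝ → V}
    (hf : ContDiff ℝ (⊤ : ℕ∞) (fun p : ℝ × ℝ => f p.1 p.2)) (u v : ℝ) :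
    HasDerivAt (fun t => f t v) (pu f u v) u :=
  ((hf.comp (contDiff_id.prodMk contDiff_const)).differentiable (by simp) u).hasDerivAt

lemma ContDiff.hasDerivAt_pv {f : ℝ → ℝ → V}
    (hf : ContDiff ℝ (⊤ : ℕ∞) (fun p : ℝ × ℝ => f p.1 p.2)) (u v : ℝ) :
    HasDerivAt (fun t => f u t) (pv f u v) v :=
  ((hf.comp (contDiff_const.prodMk contDiff_id)).differentiable (by simp) v).hasDerivAt

lemma ContDiff.contDiff_pu {f : ℝ → ℝ → V}
    (hf : ContDiff ℝ (⊤ : ℕ∞) (fun p : ℝ × ℝ => f p.1 p.2)) :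
    ContDiff ℝ (⊤ : ℕ∞) (fun p : ℝ × ℝ => pu f p.1 p.2) := by
  have h : (fun p : ℝ × ℝ => pu f p.1 p.2) =
      fun p => fderiv ℝ (fun p : ℝ × ℝ => f p.1 p.2) p (1, 0) := by
    funext p
    exact (((hf.differentiable (by simp) p).hasFDerivAt).comp_hasDerivAt p.1
      ((hasDerivAt_id p.1).prodMk (hasDerivAt_const p.1 p.2))).deriv
  rw [h]
  exact (hf.fderiv_right (by simp)).clm_apply contDiff_const

lemma ContDiff.contDiff_pv {f : ℝ → ℝ → V}
    (hf : ContDiff ℝ (⊤ : ℕ∞) (fun p : ℝ × ℝ => f p.1 p.2)) :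
    ContDiff ℝ (⊤ : ℕ∞) (fun p : ℝ × ℝ => pv f p.1 p.2) := by
  have h : (fun p : ℝ × ℝ => pv f p.1 p.2) =
      fun p => fderiv ℝ (fun p : ℝ × ℝ => f p.1 p.2) p (0, 1) := by
    funext p
    exact (((hf.differentiable (by simp) p).hasFDerivAt).comp_hasDerivAt p.2
      ((hasDerivAt_const p.2 p.1).prodMk (hasDerivAt_id p.2))).deriv
  rw [h]
  exact (hf.fderiv_right (by simp)).clm_apply contDiff_const

lemma pu_mul {f g : ℝ → ℝ → ℝ}
    (hf : ContDiff ℝ (⊤ : ℕ∞) (fun p : ℝ × ℝ => f p.1 p.2))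
    (hg : ContDiff ℝ (⊤ : ℕ∞) (fun p : ℝ × ℝ => g p.1 p.2)) (u v : ℝ) :
    pu (fun a b => f a b * g a b) u v = pu f u v * g u v + f u v * pu g u v :=
  ((hf.hasDerivAt_pu u v).mul (hg.hasDerivAt_pu u v)).deriv

lemma pv_mul {f g : ℝ → ℝ → ℝ}
    (hf : ContDiff ℝ (⊤ : ℕ∞) (fun p : ℝ × ℝ => f p.1 p.2))
    (hg : ContDiff ℝ (⊤ : ℕ∞) (fun p : ℝ × ℝ => g p.1 p.2)) (u v : ℝ) :
    pv (fun a b => f a b * g a b) u v = pv f u v * g u v + f u v * pv g u v :=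
  ((hf.hasDerivAt_pv u v).mul (hg.hasDerivAt_pv u v)).deriv

end PartialDerivatives

section InversePatch

variable {c : E3} {r : ℝ} {x y : ℝ → ℝ → E3}

/-- The first fundamental forms of a patch and of its inverse patch are conformal. -/
lemma firstFundamentalForm_inverse_patch
    (hx : ContDiff ℝ (⊤ : ℕ∞) (fun p : ℝ × ℝ => x p.1 p.2))
    (hxc : ∀ u v : ℝ, x u v ≠ c) (hy : ∀ u v : ℝ, y u v = inv3 c r (x u v)) (u v : ℝ) :
    FFE y u v = lam c r x u v ^ 2 * FFE x u v ∧
      FFF y u v = lam c r x u v ^ 2 * FFF x u v ∧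
      FFG y u v = lam c r x u v ^ 2 * FFG x u v := by
  obtain rfl : y = fun u v => inv3 c r (x u v) := funext₂ hy
  obtain ⟨L, hL, hinner⟩ := exists_hasFDerivAt_inv3 c r (hxc u v)
  have hu : pu (fun u v => inv3 c r (x u v)) u v = L (pu x u v) :=
    (HasFDerivAt.comp_hasDerivAt (f := fun t => x t v) u hL (hx.hasDerivAt_pu u v)).deriv
  have hv : pv (fun u v => inv3 c r (x u v)) u v = L (pv x u v) :=
    (HasFDerivAt.comp_hasDerivAt (f := fun t => x u t) v hL (hx.hasDerivAt_pv u v)).deriv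
  simp only [FFE, FFF, FFG, hu, hv, hinner, lam, and_self]

lemma contDiff_lam_sq (hx : ContDiff ℝ (⊤ : ℕ∞) (fun p : ℝ × ℝ => x p.1 p.2))
    (hxc : ∀ u v : ℝ, x u v ≠ c) :
    ContDiff ℝ (⊤ : ℕ∞) (fun p : ℝ × ℝ => lam c r x p.1 p.2 ^ 2) :=
  (contDiff_const.div ((hx.sub contDiff_const).norm_sq ℝ) fun p =>
    pow_ne_zero 2 (norm_ne_zero_iff.2 (sub_ne_zero.2 (hxc p.1 p.2)))).pow 2

end InversePatch

theorem inverse_patch_christoffel_symbols_principal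
    (c : E3) (r : ℝ) (hr : 0 < r)
    (x : ℝ → ℝ → E3)
    (hx : ContDiff ℝ (⊤ : ℕ∞) (fun p : ℝ × ℝ => x p.1 p.2))
    (hxc : ∀ u v : ℝ, x u v ≠ c)
    (y : ℝ → ℝ → E3) (hy : ∀ u v : ℝ, y u v = inv3 c r (x u v))
    (hreg : ∀ u v : ℝ, cross (pu x u v) (pv x u v) ≠ 0)
    (hE : ∀ u v : ℝ, 0 < FFE x u v) (hG : ∀ u v : ℝ, 0 < FFG x u v)
    (hF : ∀ u v : ℝ, FFF x u v = 0) :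
    ∀ u v : ℝ,
      Ch111 y u v = Ch111 x u v +
        (2 * lam c r x u v ^ 2)⁻¹ * pu (fun a b => lam c r x a b ^ 2) u v ∧
      Ch211 y u v = Ch211 x u v -
        (2 * lam c r x u v ^ 2)⁻¹ * (FFE x u v / FFG x u v) *
          pv (fun a b => lam c r x a b ^ 2) u v ∧
      Ch112 y u v = Ch112 x u v +
        (2 * lam c r x u v ^ 2)⁻¹ * pv (fun a b => lam c r x a b ^ 2) u v ∧
      Ch212 y u v = Ch212 x u v +
        (2 * lam c r x u v ^ 2)⁻¹ * pu (fun a b => lam c r x a b ^ 2) u v ∧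
      Ch122 y u v = Ch122 x u v -
        (2 * lam c r x u v ^ 2)⁻¹ * (FFG x u v / FFE x u v) *
          pu (fun a b => lam c r x a b ^ 2) u v ∧
      Ch222 y u v = Ch222 x u v +
        (2 * lam c r x u v ^ 2)⁻¹ * pv (fun a b => lam c r x a b ^ 2) u v := by
  intro u v
  have hform := firstFundamentalForm_inverse_patch hx hxc hy
  have hEy : FFE y = fun a b => lam c r x a b ^ 2 * FFE x a b :=
    funext₂ fun a b => (hform a b).1
  have hFx : FFF x = fun _ _ => 0 := funext₂ hF
  have hFy : FFF y = fun _ _ => 0 := funext₂ fun a b => by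
    rw [(hform a b).2.1, hF, mul_zero]
  have hGy : FFG y = fun a b => lam c r x a b ^ 2 * FFG x a b :=
    funext₂ fun a b => (hform a b).2.2
  have hlam : lam c r x u v ≠ 0 :=
    div_ne_zero (pow_ne_zero 2 hr.ne')
      (pow_ne_zero 2 (norm_ne_zero_iff.2 (sub_ne_zero.2 (hxc u v))))
  have hL := contDiff_lam_sq (r := r) hx hxc
  have hEs : ContDiff ℝ (⊤ : ℕ∞) (fun p : ℝ × ℝ => FFE x p.1 p.2) :=
    hx.contDiff_pu.inner ℝ hx.contDiff_pu
  have hGs : ContDiff ℝ (⊤ : ℕ∞) (fun p : ℝ × ℝ => FFG x p.1 p.2) :=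
    hx.contDiff_pv.inner ℝ hx.contDiff_pv
  have hE0 := (hE u v).ne'
  have hG0 := (hG u v).ne'
  have hu0 : pu (fun _ _ => (0 : ℝ)) u v = 0 := deriv_const u 0
  have hv0 : pv (fun _ _ => (0 : ℝ)) u v = 0 := deriv_const v 0
  simp only [Ch111, Ch211, Ch112, Ch212, Ch122, Ch222, hFy, hFx, hEy, hGy, hu0, hv0,
    pu_mul (f := fun a b => lam c r x a b ^ 2) hL hEs,
    pu_mul (f := fun a b => lam c r x a b ^ 2) hL hGs,
    pv_mul (f := fun a b => lam c r x a b ^ 2) hL hEs,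
    pv_mul (f := fun a b => lam c r x a b ^ 2) hL hGs]
  refine ⟨?_, ?_, ?_, ?_, ?_, ?_⟩ <;> field_simp <;> ring
end
end

section
/- (Corollary 3.5(ii)) The inversion maps a flat point into a flat point if and only if η vanishes there: if at a point (u₀,v₀) the second fundamental form coefficients of x satisfy e = f = g = 0, then ẽ = f̃ = g̃ = 0 at (u₀,v₀) if and only if η(u₀,v₀) = ⟨U_x, x − c⟩(u₀,v₀) = 0. -/
noncomputable section
open scoped RealInnerProductSpace

theorem cross_E3_apply (a b : E3) : cross a b 0 = a 1 * b 2 - a 2 * b 1 ∧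
    cross a b 1 = a 2 * b 0 - a 0 * b 2 ∧ cross a b 2 = a 0 * b 1 - a 1 * b 0 := by
  simp [cross]

theorem inner_E3 (a b : E3) : ⟪a, b⟫ = a 0 * b 0 + a 1 * b 1 + a 2 * b 2 := by
  simp [PiLp.inner_apply, Fin.sum_univ_three, mul_comm]

theorem inner_cross_left (a b : E3) : ⟪a, cross a b⟫ = 0 := by
  obtain ⟨h0, h1, h2⟩ := cross_E3_apply a b
  rw [inner_E3, h0, h1, h2]
  ring

theorem inner_cross_right (a b : E3) : ⟪b, cross a b⟫ = 0 := by
  obtain ⟨h0, h1, h2⟩ := cross_E3_apply a b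
  rw [inner_E3, h0, h1, h2]
  ring

/-- The reflection of `n` in the plane orthogonal to `z`, scaled by `⟪z, z⟫`. -/
def scaledReflection (z n : E3) : E3 := ⟪z, z⟫ • n - (2 * ⟪z, n⟫) • z

theorem scaledReflection_ne_zero {z n : E3} (hz : z ≠ 0) (hn : n ≠ 0) :
    scaledReflection z n ≠ 0 := by
  intro h
  have hzz : ⟪z, z⟫ ≠ 0 := inner_self_ne_zero.2 hz
  have hzn : ⟪z, n⟫ = 0 := by
    have h' := congrArg (fun w => ⟪z, w⟫) h
    simp only [scaledReflection, inner_sub_right, inner_smul_right, inner_zero_right] at h'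
    have : ⟪z, z⟫ * ⟪z, n⟫ = 0 := by linarith
    exact (mul_eq_zero.1 this).resolve_left hzz
  rw [scaledReflection, hzn, mul_zero, zero_smul, sub_zero] at h
  exact (smul_ne_zero hzz hn) h

theorem phiStar_eq (c : E3) (r : ℝ) (p w : E3) :
    phiStar c r p w = (r ^ 2 / ⟪p - c, p - c⟫) • w
      - (2 * r ^ 2 * ⟪p - c, w⟫ / ⟪p - c, p - c⟫ ^ 2) • (p - c) := by
  rw [phiStar, real_inner_self_eq_norm_sq, ← pow_mul]

theorem cross_phiStar (c : E3) (r : ℝ) {p : E3} (hp : p ≠ c) (a b : E3) :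
    cross (phiStar c r p a) (phiStar c r p b) =
      (-(r ^ 4 / ⟪p - c, p - c⟫ ^ 3)) • scaledReflection (p - c) (cross a b) := by
  have hq : ⟪p - c, p - c⟫ ≠ 0 := inner_self_ne_zero.2 (sub_ne_zero.2 hp)
  rw [phiStar_eq, phiStar_eq, scaledReflection]
  generalize p - c = z at *
  obtain ⟨h0, h1, h2⟩ := cross_E3_apply a b
  obtain ⟨k0, k1, k2⟩ := cross_E3_apply
    ((r ^ 2 / ⟪z, z⟫) • a - (2 * r ^ 2 * ⟪z, a⟫ / ⟪z, z⟫ ^ 2) • z)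
    ((r ^ 2 / ⟪z, z⟫) • b - (2 * r ^ 2 * ⟪z, b⟫ / ⟪z, z⟫ ^ 2) • z)
  have hq' : ⟪z, z⟫ = z 0 * z 0 + z 1 * z 1 + z 2 * z 2 := inner_E3 z z
  generalize ⟪z, z⟫ = q at *
  ext i
  fin_cases i <;>
    simp only [Fin.zero_eta, Fin.mk_one, Fin.reduceFinMk, k0, k1, k2, PiLp.sub_apply,
      PiLp.smul_apply, smul_eq_mul, h0, h1, h2] <;>
    simp only [inner_E3 z, h0, h1, h2] <;> field_simp <;> rw [hq'] <;> ring

theorem hasDerivAt_inv3_comp (c : E3) (r : ℝ) {γ : ℝ → E3} {a : E3} {t : ℝ}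
    (hγ : HasDerivAt γ a t) (hc : γ t ≠ c) :
    HasDerivAt (fun s => inv3 c r (γ s)) (phiStar c r (γ t) a) t := by
  have hq : ⟪γ t - c, γ t - c⟫ ≠ 0 := inner_self_ne_zero.2 (sub_ne_zero.2 hc)
  have hz := hγ.sub_const c
  have hl := (hasDerivAt_const t (r ^ 2)).div (hz.inner ℝ hz) hq
  have key := (hl.smul hz).const_add c
  simp only [inv3, ← real_inner_self_eq_norm_sq]
  refine key.congr_deriv ?_
  rw [phiStar_eq, real_inner_comm (γ t - c) a, sub_eq_add_neg (_ • a), ← neg_smul,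
    Pi.div_apply]
  congr 2
  ring

theorem inner_deriv_phiStar (c : E3) (r : ℝ) {γ w : ℝ → E3} {a b n : E3} {t : ℝ}
    (hγ : HasDerivAt γ a t) (hw : HasDerivAt w b t) (hc : γ t ≠ c)
    (ha : ⟪a, n⟫ = 0) (hwn : ⟪w t, n⟫ = 0) (hb : ⟪b, n⟫ = 0) :
    ⟪deriv (fun s => phiStar c r (γ s) (w s)) t, scaledReflection (γ t - c) n⟫ =
      2 * r ^ 2 / ⟪γ t - c, γ t - c⟫ * ⟪a, w t⟫ * ⟪γ t - c, n⟫ := by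
  have hq : ⟪γ t - c, γ t - c⟫ ≠ 0 := inner_self_ne_zero.2 (sub_ne_zero.2 hc)
  have hz := hγ.sub_const c
  have hqd := hz.inner ℝ hz
  have h1 := ((hasDerivAt_const t (r ^ 2)).div hqd hq).smul hw
  have h2 := ((((hz.inner ℝ hw).const_mul (2 * r ^ 2)).div (hqd.pow 2)
    (pow_ne_zero 2 hq)).smul hz)
  have key := (h1.sub h2).congr_of_eventuallyEq
    (Filter.Eventually.of_forall fun s => phiStar_eq c r (γ s) (w s))
  rw [key.deriv, scaledReflection]
  simp only [Pi.div_apply, Pi.pow_apply]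
  clear key h1 h2 hqd hz
  generalize γ t - c = z at *
  simp only [inner_sub_right, inner_sub_left, inner_add_left, real_inner_smul_left,
    real_inner_smul_right, ha, hwn, hb, real_inner_comm z]
  field_simp
  ring

theorem pu_eq_fderiv {E : Type*} [NormedAddCommGroup E] [NormedSpace ℝ E] {x : ℝ → ℝ → E}
    (hx : Differentiable ℝ (fun p : ℝ × ℝ => x p.1 p.2)) (u v : ℝ) :
    pu x u v = fderiv ℝ (fun p : ℝ × ℝ => x p.1 p.2) (u, v) (1, 0) :=
  ((hx (u, v)).hasFDerivAt.comp_hasDerivAt_of_eq (f := fun t => (t, v)) u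
    ((hasDerivAt_id' u).prodMk (hasDerivAt_const u v)) rfl).deriv

theorem pv_eq_fderiv {E : Type*} [NormedAddCommGroup E] [NormedSpace ℝ E] {x : ℝ → ℝ → E}
    (hx : Differentiable ℝ (fun p : ℝ × ℝ => x p.1 p.2)) (u v : ℝ) :
    pv x u v = fderiv ℝ (fun p : ℝ × ℝ => x p.1 p.2) (u, v) (0, 1) :=
  ((hx (u, v)).hasFDerivAt.comp_hasDerivAt_of_eq (f := fun t => (u, t)) v
    ((hasDerivAt_const v u).prodMk (hasDerivAt_id' v)) rfl).deriv

theorem hasDerivAt_pu {E : Type*} [NormedAddCommGroup E] [NormedSpace ℝ E] {x : ℝ → ℝ → E}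
    (hx : Differentiable ℝ (fun p : ℝ × ℝ => x p.1 p.2)) (u v : ℝ) :
    HasDerivAt (fun t => x t v) (pu x u v) u :=
  (hx.comp (differentiable_id.prodMk (differentiable_const v)) u).hasDerivAt

theorem hasDerivAt_pv {E : Type*} [NormedAddCommGroup E] [NormedSpace ℝ E] {x : ℝ → ℝ → E}
    (hx : Differentiable ℝ (fun p : ℝ × ℝ => x p.1 p.2)) (u v : ℝ) :
    HasDerivAt (fun t => x u t) (pv x u v) v :=
  (hx.comp ((differentiable_const u).prodMk differentiable_id) v).hasDerivAt

theorem differentiable_pu {E : Type*} [NormedAddCommGroup E] [NormedSpace ℝ E] {x : ℝ → ℝ → E}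
    (hx : ContDiff ℝ 2 (fun p : ℝ × ℝ => x p.1 p.2)) :
    Differentiable ℝ (fun p : ℝ × ℝ => pu x p.1 p.2) := by
  simp only [pu_eq_fderiv (hx.differentiable two_ne_zero)]
  exact ((hx.fderiv_right (m := 1) (by norm_num)).differentiable one_ne_zero).clm_apply
    (differentiable_const _)

theorem differentiable_pv {E : Type*} [NormedAddCommGroup E] [NormedSpace ℝ E] {x : ℝ → ℝ → E}
    (hx : ContDiff ℝ 2 (fun p : ℝ × ℝ => x p.1 p.2)) :
    Differentiable ℝ (fun p : ℝ × ℝ => pv x p.1 p.2) := by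
  simp only [pv_eq_fderiv (hx.differentiable two_ne_zero)]
  exact ((hx.fderiv_right (m := 1) (by norm_num)).differentiable one_ne_zero).clm_apply
    (differentiable_const _)

theorem inversion_maps_flat_points_to_flat_points_iff
    (c : E3) (r : ℝ) (hr : 0 < r)
    (x : ℝ → ℝ → E3)
    (hx : ContDiff ℝ (⊤ : ℕ∞) (fun p : ℝ × ℝ => x p.1 p.2))
    (hxc : ∀ u v : ℝ, x u v ≠ c)
    (y : ℝ → ℝ → E3) (hy : ∀ u v : ℝ, y u v = inv3 c r (x u v))
    (hreg : ∀ u v : ℝ, cross (pu x u v) (pv x u v) ≠ 0)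
    (u₀ v₀ : ℝ)
    (he : SFe x u₀ v₀ = 0) (hf : SFf x u₀ v₀ = 0) (hg : SFg x u₀ v₀ = 0) :
    (SFe y u₀ v₀ = 0 ∧ SFf y u₀ v₀ = 0 ∧ SFg y u₀ v₀ = 0) ↔ eta c x u₀ v₀ = 0 := by
  have hx2 : ContDiff ℝ 2 (fun p : ℝ × ℝ => x p.1 p.2) := contDiff_infty.1 hx 2
  have hd := hx2.differentiable two_ne_zero
  have hyu : pu y = fun u v => phiStar c r (x u v) (pu x u v) := by
    funext u v
    simp only [pu, hy]
    exact (hasDerivAt_inv3_comp c r (hasDerivAt_pu hd u v) (hxc u v)).deriv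
  have hyv : pv y = fun u v => phiStar c r (x u v) (pv x u v) := by
    funext u v
    simp only [pv, hy]
    exact (hasDerivAt_inv3_comp c r (hasDerivAt_pv hd u v) (hxc u v)).deriv
  set n := cross (pu x u₀ v₀) (pv x u₀ v₀) with hn
  set z := x u₀ v₀ - c with hz
  have hn0 : n ≠ 0 := hreg u₀ v₀
  have hz0 : z ≠ 0 := sub_ne_zero.2 (hxc u₀ v₀)
  have hzz : ⟪z, z⟫ ≠ 0 := inner_self_ne_zero.2 hz0
  have hnn : ‖n‖⁻¹ ≠ 0 := inv_ne_zero (norm_ne_zero_iff.2 hn0)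
  have hun : pu x u₀ v₀ ≠ 0 := by
    intro h
    apply hn0
    ext i
    fin_cases i <;> simp [hn, h, cross]
  have hcross : cross (pu y u₀ v₀) (pv y u₀ v₀) =
      (-(r ^ 4 / ⟪z, z⟫ ^ 3)) • scaledReflection z n := by
    rw [hyu, hyv]
    exact cross_phiStar c r (hxc u₀ v₀) _ _
  obtain ⟨k, hk, hUy⟩ : ∃ k : ℝ, k ≠ 0 ∧ unormal y u₀ v₀ = k • scaledReflection z n := by
    have hs : -(r ^ 4 / ⟪z, z⟫ ^ 3) ≠ 0 :=
      neg_ne_zero.2 (div_ne_zero (pow_ne_zero _ hr.ne') (pow_ne_zero _ hzz))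
    have hW := smul_ne_zero hs (scaledReflection_ne_zero hz0 hn0)
    refine ⟨_, mul_ne_zero (inv_ne_zero (norm_ne_zero_iff.2 hW)) hs, ?_⟩
    rw [unormal, hcross, smul_smul]
  have orth {w : E3} (h : ⟪w, unormal x u₀ v₀⟫ = 0) : ⟪w, n⟫ = 0 := by
    rw [unormal, inner_smul_right] at h
    exact (mul_eq_zero.1 h).resolve_left hnn
  have hna := inner_cross_left (pu x u₀ v₀) (pv x u₀ v₀)
  have hnb := inner_cross_right (pu x u₀ v₀) (pv x u₀ v₀)
  have hpu := differentiable_pu hx2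
  have hpv := differentiable_pv hx2
  have huu := inner_deriv_phiStar c r (hasDerivAt_pu hd u₀ v₀) (hasDerivAt_pu hpu u₀ v₀)
    (hxc u₀ v₀) hna hna (orth he)
  have huv := inner_deriv_phiStar c r (hasDerivAt_pv hd u₀ v₀) (hasDerivAt_pv hpu u₀ v₀)
    (hxc u₀ v₀) hnb hna (orth hf)
  have hvv := inner_deriv_phiStar c r (hasDerivAt_pv hd u₀ v₀) (hasDerivAt_pv hpv u₀ v₀)
    (hxc u₀ v₀) hnb hnb (orth hg)
  have hE : SFe y u₀ v₀ = k * (2 * r ^ 2 / ⟪z, z⟫ * FFE x u₀ v₀ * ⟪z, n⟫) := by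
    rw [SFe, hUy, inner_smul_right, hyu]
    exact congrArg (k * ·) huu
  have hF : SFf y u₀ v₀ = k * (2 * r ^ 2 / ⟪z, z⟫ * ⟪pv x u₀ v₀, pu x u₀ v₀⟫ * ⟪z, n⟫) := by
    rw [SFf, hUy, inner_smul_right, hyu]
    exact congrArg (k * ·) huv
  have hG : SFg y u₀ v₀ = k * (2 * r ^ 2 / ⟪z, z⟫ * FFG x u₀ v₀ * ⟪z, n⟫) := by
    rw [SFg, hUy, inner_smul_right, hyv]
    exact congrArg (k * ·) hvv
  have hη : eta c x u₀ v₀ = ‖n‖⁻¹ * ⟪z, n⟫ := by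
    rw [eta, unormal, inner_smul_left, real_inner_comm]
    rfl
  have hFFE : FFE x u₀ v₀ ≠ 0 := inner_self_ne_zero.2 hun
  rw [hE, hF, hG, hη]
  constructor
  · rintro ⟨h, -, -⟩
    simpa [hk, hr.ne', hzz, hFFE, hnn, hz0] using h
  · intro h
    have h0 : ⟪z, n⟫ = 0 := (mul_eq_zero.1 h).resolve_left hnn
    simp [h0]
end
end
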